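/- Let (V, C, I) be a Freyd operad. The presheaf V : CSUB[V]^op → Set is representable by the object 1: for each n, the map sending v ∈ V(n) to the class of the singleton word [⟨0 ⊣ v ⊢ 0⟩] is a bijection V(n) ≅ CSUB[V](n,1), with inverse sending a class s to id ⋆ s, and this bijection is natural with respect to the action of CSUB[V]. -/

import Mathlib

universe u

/-- A renaming from `m` to `n` is a function `Fin m → Fin n`. -/
abbrev Ren (m n : ℕ) : Type := Fin m → Fin n

/-- The identity renaming. -/
def idRen (n : ℕ) : Ren n n := fun i => i

/-- Block sum of renamings. -/
def bsum {m₁ n₁ m₂ n₂ : ℕ} (r : Ren m₁ n₁) (r' : Ren m₂ n₂) : Ren (m₁ + m₂) (n₁ + n₂) :=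
  fun i => Fin.addCases (motive := fun _ => Fin (n₁ + n₂))
    (fun a => Fin.castAdd n₂ (r a)) (fun b => Fin.natAdd n₁ (r' b)) i

/-- The block swap `σ_{m,n} : m+n → n+m`. -/
def swapRen (m n : ℕ) : Ren (m + n) (n + m) :=
  fun i => Fin.addCases (motive := fun _ => Fin (n + m))
    (fun a => Fin.natAdd n a) (fun b => Fin.castAdd m b) i

/-- The copy renaming `Δ_n : n+n → n`, sending both copies of `i` to `i`. -/
def copyRen (n : ℕ) : Ren (n + n) n :=
  fun i => Fin.addCases (motive := fun _ => Fin n) (fun a => a) (fun b => b) i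

/-- The discard renaming `!_n : 0 → n` (the empty function). -/
def discardRen (n : ℕ) : Ren 0 n := fun i => i.elim0

/-- Cast along an equality of arities. -/
def acast {C : ℕ → Type u} {m n : ℕ} (h : m = n) : C m → C n := fun x => h ▸ x

/-- Cast along equalities of both arities. -/
def hcast {H : ℕ → ℕ → Type u} {a a' b b' : ℕ} (h₁ : a = a') (h₂ : b = b') : H a b → H a' b' :=
  fun f => h₂ ▸ h₁ ▸ f

/-- A preoperad: a family of sets `C n` with an identity `one ∈ C 1` and single
substitution `f{n₁ ⊣ g ⊢ n₂}`, satisfying unit and associativity laws. -/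
structure Preoperad where
  C : ℕ → Type
  one : C 1
  subst : ∀ (n₁ n₂ : ℕ) {m : ℕ}, C (n₁ + 1 + n₂) → C m → C (n₁ + m + n₂)
  left_unit : ∀ {m : ℕ} (g : C m), subst 0 0 one g = acast (C := C) (by omega) g
  right_unit : ∀ {n₁ n₂ : ℕ} (f : C (n₁ + 1 + n₂)), subst n₁ n₂ f one = f
  assoc : ∀ {m₁ m₂ n₁ n₂ k : ℕ} (f : C (m₁ + 1 + m₂)) (g : C (n₁ + 1 + n₂)) (h : C k),
    subst (m₁ + n₁) (n₂ + m₂) (acast (C := C) (by omega) (subst m₁ m₂ f g)) h =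
      acast (C := C) (by omega) (subst m₁ m₂ f (subst n₁ n₂ g h))

/-- Two elements `g₁ ∈ C k₁`, `g₂ ∈ C k₂` of a preoperad commute when substituting them
into the two distinguished inputs of any morphism in either order yields the same
result (in both orientations). -/
def Preoperad.Commute (P : Preoperad) {k₁ k₂ : ℕ} (g₁ : P.C k₁) (g₂ : P.C k₂) : Prop :=
  ∀ (m₁ m m₂ : ℕ) (f : P.C (m₁ + 1 + m + 1 + m₂)),
    (P.subst (m₁ + k₁ + m) m₂
        (acast (C := P.C) (by omega)
          (P.subst m₁ (m + 1 + m₂) (acast (C := P.C) (by omega) f) g₁)) g₂ =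
      acast (C := P.C) (by omega)
        (P.subst m₁ (m + k₂ + m₂)
          (acast (C := P.C) (by omega) (P.subst (m₁ + 1 + m) m₂ f g₂)) g₁)) ∧
    (P.subst (m₁ + k₂ + m) m₂
        (acast (C := P.C) (by omega)
          (P.subst m₁ (m + 1 + m₂) (acast (C := P.C) (by omega) f) g₂)) g₁ =
      acast (C := P.C) (by omega)
        (P.subst m₁ (m + k₁ + m₂)
          (acast (C := P.C) (by omega) (P.subst (m₁ + 1 + m) m₂ f g₁)) g₂))

/-- An element is central if it commutes with every element. -/
def Preoperad.Central (P : Preoperad) {k : ℕ} (g : P.C k) : Prop :=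
  ∀ {k' : ℕ} (g' : P.C k'), P.Commute g g'

/-- A `Ren`-cartesian preoperad: a preoperad equipped with reindexing `f[r]` along all
renamings, functorially, and satisfying the renaming–substitution interchange law. -/
structure RenPreoperad extends Preoperad where
  ren : ∀ {m n : ℕ}, C m → Ren m n → C n
  ren_id : ∀ {m : ℕ} (f : C m), ren f (idRen m) = f
  ren_comp : ∀ {m n k : ℕ} (f : C m) (r₁ : Ren m n) (r₂ : Ren n k),
    ren f (r₂ ∘ r₁) = ren (ren f r₁) r₂
  ren_subst : ∀ {n₁ n₂ k m₁ m₂ m : ℕ} (f : C (n₁ + 1 + n₂)) (g : C k)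
      (r₁ : Ren n₁ m₁) (r : Ren k m) (r₂ : Ren n₂ m₂),
    ren (subst n₁ n₂ f g) (bsum (bsum r₁ r) r₂) =
      subst m₁ m₂ (ren f (bsum (bsum r₁ (idRen 1)) r₂)) (ren g r)

/-- A symmetric `Ren`-cartesian preoperad: transpositions are natural with respect to
single substitution, in both orientations. -/
structure SymRenPreoperad extends RenPreoperad where
  sym_nat₁ : ∀ {m₁ m₂ n : ℕ} (f : C (m₁ + 2 + m₂)) (g : C n),
    subst m₁ (1 + m₂)
        (acast (C := C) (by omega)
          (ren f (bsum (bsum (idRen m₁) (swapRen 1 1)) (idRen m₂)))) g =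
      acast (C := C) (by omega)
        (ren (acast (C := C) (by omega) (subst (m₁ + 1) m₂ f g))
          (bsum (bsum (idRen m₁) (swapRen 1 n)) (idRen m₂)))
  sym_nat₂ : ∀ {m₁ m₂ n : ℕ} (f : C (m₁ + 2 + m₂)) (g : C n),
    subst (m₁ + 1) m₂
        (ren f ((bsum (bsum (idRen m₁) (swapRen 1 1)) (idRen m₂) :
          Ren (m₁ + (1 + 1) + m₂) (m₁ + (1 + 1) + m₂)))) g =
      acast (C := C) (by omega)
        (ren (acast (C := C) (by omega) (subst m₁ (1 + m₂) (acast (C := C) (by omega) f) g))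
          (bsum (bsum (idRen m₁) (swapRen n 1)) (idRen m₂)))

/-- A cartesian operad: a `Ren`-cartesian symmetric preoperad in which every element is
central and in which discard and copy are natural with respect to single substitution. -/
structure CartOperad extends SymRenPreoperad where
  central : ∀ {k : ℕ} (g : C k), toPreoperad.Central g
  discard_nat : ∀ {m₁ m₂ n : ℕ} (f : C (m₁ + 0 + m₂)) (g : C n),
    subst m₁ m₂
        (ren f ((bsum (bsum (idRen m₁) (discardRen 1)) (idRen m₂) :
          Ren (m₁ + 0 + m₂) (m₁ + 1 + m₂)))) g =
      ren f ((bsum (bsum (idRen m₁) (discardRen n)) (idRen m₂) :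
        Ren (m₁ + 0 + m₂) (m₁ + n + m₂)))
  copy_nat : ∀ {m₁ m₂ n : ℕ} (f : C (m₁ + 2 + m₂)) (g : C n),
    subst m₁ m₂
        (ren f ((bsum (bsum (idRen m₁) (copyRen 1)) (idRen m₂) :
          Ren (m₁ + (1 + 1) + m₂) (m₁ + 1 + m₂)))) g =
      ren (acast (C := C) (by omega)
            (subst m₁ (n + m₂) (acast (C := C) (by omega) (subst (m₁ + 1) m₂ f g)) g))
        ((bsum (bsum (idRen m₁) (copyRen n)) (idRen m₂) :
          Ren (m₁ + (n + n) + m₂) (m₁ + n + m₂)))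

/-- A cartesian preoperad functor: preserves the identity, single substitution and
reindexing. -/
structure RenPreoperadHom (P Q : RenPreoperad) where
  map : ∀ {n : ℕ}, P.C n → Q.C n
  map_one : map P.one = Q.one
  map_subst : ∀ {n₁ n₂ m : ℕ} (f : P.C (n₁ + 1 + n₂)) (g : P.C m),
    map (P.subst n₁ n₂ f g) = Q.subst n₁ n₂ (map f) (map g)
  map_ren : ∀ {m n : ℕ} (f : P.C m) (r : Ren m n), map (P.ren f r) = Q.ren (map f) r

/-- Composition of cartesian preoperad functors. -/
def RenPreoperadHom.comp {P Q R : RenPreoperad} (F : RenPreoperadHom P Q)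
    (G : RenPreoperadHom Q R) : RenPreoperadHom P R where
  map f := G.map (F.map f)
  map_one := by show G.map (F.map P.one) = _; rw [F.map_one, G.map_one]
  map_subst f g := by
    show G.map (F.map _) = _
    rw [F.map_subst, G.map_subst]
  map_ren f r := by
    show G.map (F.map _) = _
    rw [F.map_ren, G.map_ren]

/-- A Freyd operad: a cartesian operad `V` of values, a symmetric `Ren`-cartesian
preoperad `C` of computations, and a cartesian preoperad functor `I : V → C` whose image
consists of central elements (and hence forms a cartesian operad). -/
structure FreydOperad where
  V : CartOperad
  C : SymRenPreoperad
  I : RenPreoperadHom V.toRenPreoperad C.toRenPreoperad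
  I_central : ∀ {n : ℕ} (v : V.C n), C.toPreoperad.Central (I.map v)

/-- A Freyd operad functor: a pair of cartesian preoperad functors commuting with the
functors `I`. -/
structure FreydOperadHom (O₁ O₂ : FreydOperad) where
  mapV : RenPreoperadHom O₁.V.toRenPreoperad O₂.V.toRenPreoperad
  mapC : RenPreoperadHom O₁.C.toRenPreoperad O₂.C.toRenPreoperad
  square : ∀ {n : ℕ} (v : O₁.V.C n), mapC.map (O₁.I.map v) = O₂.I.map (mapV.map v)

/-- Composition of Freyd operad functors. -/
def FreydOperadHom.comp {O₁ O₂ O₃ : FreydOperad} (F : FreydOperadHom O₁ O₂)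
    (G : FreydOperadHom O₂ O₃) : FreydOperadHom O₁ O₃ where
  mapV := F.mapV.comp G.mapV
  mapC := F.mapC.comp G.mapC
  square v := by
    show G.mapC.map (F.mapC.map _) = _
    rw [F.square, G.square]; rfl

/-- A weakly closed Freyd operad: abstraction `λₙ : C(n+1) → V(n)` and application
`@ ∈ C 2` satisfying the β-law and compatibility of abstraction with substitution. -/
structure WCFreydOperad extends FreydOperad where
  abs : ∀ {n : ℕ}, C.C (n + 1) → V.C n
  app : C.C 2
  beta : ∀ {n : ℕ} (f : C.C (n + 1)),
    C.subst 0 1 app (I.map (abs f)) = acast (C := C.C) (by omega) f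
  abs_subst : ∀ {m₁ m₂ k : ℕ} (f : C.C (m₁ + 1 + (m₂ + 1))) (v : V.C k),
    abs (acast (C := C.C) (by omega) (C.subst m₁ (m₂ + 1) f (I.map v))) =
      V.subst m₁ m₂ (abs (acast (C := C.C) (by omega) f)) v

/-- Pre-substitutions over a family of carriers `C`: finite words of single
substitutions `⟨m₁ ⊣ g ⊢ m₂⟩` and renamings (read contravariantly), with matching
arities.  A term `s : PreSub C m n` is a word from `m` to `n`; the head of the word is
the step applied first to an element of `C n`. -/
inductive PreSub (C : ℕ → Type) : ℕ → ℕ → Type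
  | nil {n : ℕ} : PreSub C n n
  | subCons {m : ℕ} (m₁ m₂ : ℕ) {k : ℕ} (g : C k) (rest : PreSub C m (m₁ + k + m₂)) :
      PreSub C m (m₁ + 1 + m₂)
  | renCons {m a b : ℕ} (r : Ren a b) (rest : PreSub C m b) : PreSub C m a

namespace PreSub

variable {C : ℕ → Type}

/-- Cast a pre-substitution along an equality of its upper arity. -/
def castU {m n n' : ℕ} (h : n = n') (s : PreSub C m n) : PreSub C m n' := h ▸ s

/-- Concatenation (composition) of pre-substitutions. -/
def append : ∀ {m k n : ℕ}, PreSub C k n → PreSub C m k → PreSub C m n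
  | _, _, _, .nil, t => t
  | _, _, _, .subCons m₁ m₂ g rest, t => .subCons m₁ m₂ g (rest.append t)
  | _, _, _, .renCons r rest, t => .renCons r (rest.append t)

/-- Left whiskering of a pre-substitution, padding each step by `l` unused variables on
the left. -/
def whiskL (l : ℕ) : ∀ {m n : ℕ}, PreSub C m n → PreSub C (l + m) (l + n)
  | _, _, .nil => .nil
  | _, _, .subCons m₁ m₂ g rest =>
      castU (by omega) (.subCons (l + m₁) m₂ g (castU (by omega) (whiskL l rest)))
  | _, _, .renCons r rest => .renCons (bsum (idRen l) r) (whiskL l rest)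

/-- Right whiskering of a pre-substitution, padding each step by `l` unused variables on
the right. -/
def whiskR (l : ℕ) : ∀ {m n : ℕ}, PreSub C m n → PreSub C (m + l) (n + l)
  | _, _, .nil => .nil
  | _, _, .subCons m₁ m₂ g rest =>
      castU (by omega) (.subCons m₁ (m₂ + l) g (castU (by omega) (whiskR l rest)))
  | _, _, .renCons r rest => .renCons (bsum r (idRen l)) (whiskR l rest)

/-- Apply `F` to every substitution step of a word, leaving renaming steps unchanged. -/
def mapWord {C₁ C₂ : ℕ → Type} (F : ∀ {k : ℕ}, C₁ k → C₂ k) :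
    ∀ {m n : ℕ}, PreSub C₁ m n → PreSub C₂ m n
  | _, _, .nil => .nil
  | _, _, .subCons m₁ m₂ g rest => .subCons m₁ m₂ (F g) (mapWord F rest)
  | _, _, .renCons r rest => .renCons r (mapWord F rest)

/-- The singleton word `[⟨0 ⊣ g ⊢ 0⟩] : n → 1` associated to `g ∈ C n`. -/
def sing {n : ℕ} (g : C n) : PreSub C n 1 :=
  .subCons 0 0 g (castU (by omega) .nil)

end PreSub

/-- Application `f ⋆ s` of a pre-substitution `s : m → n` to `f ∈ C n`, yielding an
element of `C m`: substitution steps act by single substitution and renaming steps by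
reindexing, in the order of the word. -/
def PreSub.apply (P : RenPreoperad) : ∀ {m n : ℕ}, PreSub P.C m n → P.C n → P.C m
  | _, _, .nil, f => f
  | _, _, .subCons m₁ m₂ g rest, f => PreSub.apply P rest (P.subst m₁ m₂ f g)
  | _, _, .renCons r rest, f => PreSub.apply P rest (P.ren f r)

/-- The congruence on pre-substitutions generated by the symmetric rules of the
substitution construction (rules apply in arbitrary word contexts). -/
inductive SubEquiv (P : SymRenPreoperad) : {m n : ℕ} → PreSub P.C m n → PreSub P.C m n → Prop
  | refl {m n : ℕ} (s : PreSub P.C m n) : SubEquiv P s s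
  | symm {m n : ℕ} {s t : PreSub P.C m n} : SubEquiv P s t → SubEquiv P t s
  | trans {m n : ℕ} {s t u : PreSub P.C m n} :
      SubEquiv P s t → SubEquiv P t u → SubEquiv P s u
  | congrSub {m m₁ m₂ k : ℕ} (g : P.C k) {s t : PreSub P.C m (m₁ + k + m₂)} :
      SubEquiv P s t → SubEquiv P (.subCons m₁ m₂ g s) (.subCons m₁ m₂ g t)
  | congrRen {m a b : ℕ} (r : Ren a b) {s t : PreSub P.C m b} :
      SubEquiv P s t → SubEquiv P (.renCons r s) (.renCons r t)
  /-- (U₁) identity substitution steps are deleted -/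
  | unit₁ {m m₁ m₂ : ℕ} (s : PreSub P.C m (m₁ + 1 + m₂)) :
      SubEquiv P (.subCons m₁ m₂ P.one s) s
  /-- (U₂) identity renaming steps are deleted -/
  | unit₂ {m n : ℕ} (s : PreSub P.C m n) : SubEquiv P (.renCons (idRen n) s) s
  /-- (A) adjacent compatible substitution steps merge by operadic composition -/
  | merge {m m₁ m₂ n₁ n₂ k : ℕ} (g : P.C (n₁ + 1 + n₂)) (h : P.C k)
      (rest : PreSub P.C m (m₁ + n₁ + k + (n₂ + m₂))) :
      SubEquiv P
        (.subCons m₁ m₂ g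
          (PreSub.castU (by omega) (.subCons (m₁ + n₁) (n₂ + m₂) h rest)))
        (.subCons m₁ m₂ (P.subst n₁ n₂ g h) (PreSub.castU (by omega) rest))
  /-- (R) adjacent renaming steps compose -/
  | renComp {m a b c : ℕ} (r₁ : Ren a b) (r₂ : Ren b c) (rest : PreSub P.C m c) :
      SubEquiv P (.renCons r₁ (.renCons r₂ rest)) (.renCons (r₂ ∘ r₁) rest)
  /-- (N) a substitution step followed by a compatible renaming equals the reindexed
  substitution preceded by a renaming -/
  | interchange {m n₁ n₂ k a b c : ℕ} (v : P.C k)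
      (ρ₁ : Ren n₁ a) (ρ : Ren k b) (ρ₂ : Ren n₂ c)
      (rest : PreSub P.C m (a + b + c)) :
      SubEquiv P
        (.subCons n₁ n₂ v (.renCons (bsum (bsum ρ₁ ρ) ρ₂) rest))
        (.renCons (bsum (bsum ρ₁ (idRen 1)) ρ₂) (.subCons a c (P.ren v ρ) rest))
  /-- (S_ℓ) transposition renamings commute with substitution steps -/
  | symL {m m₁ m₂ n : ℕ} (g : P.C n) (rest : PreSub P.C m (m₁ + n + (1 + m₂))) :
      SubEquiv P
        (.renCons (bsum (bsum (idRen m₁) (swapRen 1 1)) (idRen m₂))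
          (PreSub.castU (by omega) (.subCons m₁ (1 + m₂) g rest)))
        (.subCons (m₁ + 1) m₂ g
          (PreSub.castU (by omega)
            (.renCons (bsum (bsum (idRen m₁) (swapRen 1 n)) (idRen m₂))
              (PreSub.castU (by omega) rest))))
  /-- (S_r) transposition renamings commute with substitution steps -/
  | symR {m m₁ m₂ n : ℕ} (g : P.C n) (rest : PreSub P.C m (m₁ + 1 + n + m₂)) :
      SubEquiv P
        (.renCons (bsum (bsum (idRen m₁) (swapRen 1 1)) (idRen m₂))
          (.subCons (m₁ + 1) m₂ g (PreSub.castU (by omega) rest)))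
        (PreSub.castU (by omega)
          (.subCons m₁ (1 + m₂) g
            (PreSub.castU (by omega)
              (.renCons (bsum (bsum (idRen m₁) (swapRen n 1)) (idRen m₂))
                (PreSub.castU (by omega) rest)))))

/-- The congruence on pre-substitutions generated by the symmetric rules together with
the cartesian rules (centrality of substitution steps, naturality of discard and copy). -/
inductive CSubEquiv (V : CartOperad) : {m n : ℕ} → PreSub V.C m n → PreSub V.C m n → Prop
  | refl {m n : ℕ} (s : PreSub V.C m n) : CSubEquiv V s s
  | symm {m n : ℕ} {s t : PreSub V.C m n} : CSubEquiv V s t → CSubEquiv V t s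
  | trans {m n : ℕ} {s t u : PreSub V.C m n} :
      CSubEquiv V s t → CSubEquiv V t u → CSubEquiv V s u
  | congrSub {m m₁ m₂ k : ℕ} (g : V.C k) {s t : PreSub V.C m (m₁ + k + m₂)} :
      CSubEquiv V s t → CSubEquiv V (.subCons m₁ m₂ g s) (.subCons m₁ m₂ g t)
  | congrRen {m a b : ℕ} (r : Ren a b) {s t : PreSub V.C m b} :
      CSubEquiv V s t → CSubEquiv V (.renCons r s) (.renCons r t)
  | unit₁ {m m₁ m₂ : ℕ} (s : PreSub V.C m (m₁ + 1 + m₂)) :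
      CSubEquiv V (.subCons m₁ m₂ V.one s) s
  | unit₂ {m n : ℕ} (s : PreSub V.C m n) : CSubEquiv V (.renCons (idRen n) s) s
  | merge {m m₁ m₂ n₁ n₂ k : ℕ} (g : V.C (n₁ + 1 + n₂)) (h : V.C k)
      (rest : PreSub V.C m (m₁ + n₁ + k + (n₂ + m₂))) :
      CSubEquiv V
        (.subCons m₁ m₂ g
          (PreSub.castU (by omega) (.subCons (m₁ + n₁) (n₂ + m₂) h rest)))
        (.subCons m₁ m₂ (V.subst n₁ n₂ g h) (PreSub.castU (by omega) rest))
  | renComp {m a b c : ℕ} (r₁ : Ren a b) (r₂ : Ren b c) (rest : PreSub V.C m c) :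
      CSubEquiv V (.renCons r₁ (.renCons r₂ rest)) (.renCons (r₂ ∘ r₁) rest)
  | interchange {m n₁ n₂ k a b c : ℕ} (v : V.C k)
      (ρ₁ : Ren n₁ a) (ρ : Ren k b) (ρ₂ : Ren n₂ c)
      (rest : PreSub V.C m (a + b + c)) :
      CSubEquiv V
        (.subCons n₁ n₂ v (.renCons (bsum (bsum ρ₁ ρ) ρ₂) rest))
        (.renCons (bsum (bsum ρ₁ (idRen 1)) ρ₂) (.subCons a c (V.ren v ρ) rest))
  | symL {m m₁ m₂ n : ℕ} (g : V.C n) (rest : PreSub V.C m (m₁ + n + (1 + m₂))) :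
      CSubEquiv V
        (.renCons (bsum (bsum (idRen m₁) (swapRen 1 1)) (idRen m₂))
          (PreSub.castU (by omega) (.subCons m₁ (1 + m₂) g rest)))
        (.subCons (m₁ + 1) m₂ g
          (PreSub.castU (by omega)
            (.renCons (bsum (bsum (idRen m₁) (swapRen 1 n)) (idRen m₂))
              (PreSub.castU (by omega) rest))))
  | symR {m m₁ m₂ n : ℕ} (g : V.C n) (rest : PreSub V.C m (m₁ + 1 + n + m₂)) :
      CSubEquiv V
        (.renCons (bsum (bsum (idRen m₁) (swapRen 1 1)) (idRen m₂))
          (.subCons (m₁ + 1) m₂ g (PreSub.castU (by omega) rest)))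
        (PreSub.castU (by omega)
          (.subCons m₁ (1 + m₂) g
            (PreSub.castU (by omega)
              (.renCons (bsum (bsum (idRen m₁) (swapRen n 1)) (idRen m₂))
                (PreSub.castU (by omega) rest)))))
  /-- (CEN) adjacent independent substitution steps commute -/
  | cen {m' m₁ m m₂ n₁ n₂ : ℕ} (g₁ : V.C n₁) (g₂ : V.C n₂)
      (rest : PreSub V.C m' (m₁ + n₁ + m + n₂ + m₂)) :
      CSubEquiv V
        (.subCons m₁ (m + 1 + m₂) g₁
          (PreSub.castU (by omega) (.subCons (m₁ + n₁ + m) m₂ g₂ rest)))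
        (PreSub.castU (by omega)
          (.subCons (m₁ + 1 + m) m₂ g₂
            (PreSub.castU (by omega)
              (.subCons m₁ (m + n₂ + m₂) g₁ (PreSub.castU (by omega) rest)))))
  /-- (D) a discard renaming followed by a substitution step equals a discard renaming -/
  | dis {m m₁ m₂ n : ℕ} (g : V.C n) (rest : PreSub V.C m (m₁ + n + m₂)) :
      CSubEquiv V
        (.renCons (bsum (bsum (idRen m₁) (discardRen 1)) (idRen m₂) :
            Ren (m₁ + 0 + m₂) (m₁ + 1 + m₂))
          (.subCons m₁ m₂ g rest))
        (.renCons (bsum (bsum (idRen m₁) (discardRen n)) (idRen m₂) :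
            Ren (m₁ + 0 + m₂) (m₁ + n + m₂))
          rest)
  /-- (C) a copy renaming followed by a substitution step equals a doubled substitution
  step followed by a copy renaming -/
  | cop {m m₁ m₂ n : ℕ} (g : V.C n) (rest : PreSub V.C m (m₁ + n + m₂)) :
      CSubEquiv V
        (.renCons (bsum (bsum (idRen m₁) (copyRen 1)) (idRen m₂) :
            Ren (m₁ + (1 + 1) + m₂) (m₁ + 1 + m₂))
          (.subCons m₁ m₂ g rest))
        (.subCons (m₁ + 1) m₂ g
          (PreSub.castU (by omega)
            (.subCons m₁ (n + m₂) g
              (PreSub.castU (by omega)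
                (.renCons (bsum (bsum (idRen m₁) (copyRen n)) (idRen m₂) :
                    Ren (m₁ + (n + n) + m₂) (m₁ + n + m₂))
                  rest)))))

/-- Morphisms of the substitution category `SUB[C]`: pre-substitutions modulo the
symmetric rules. -/
abbrev SUBQ (P : SymRenPreoperad) (m n : ℕ) : Type := Quot (@SubEquiv P m n)

/-- Morphisms of the cartesian substitution category `CSUB[V]`: pre-substitutions modulo
the symmetric rules together with the cartesian rules. -/
abbrev CSUBQ (V : CartOperad) (m n : ℕ) : Type := Quot (@CSubEquiv V m n)

theorem acast_rfl {C : ℕ → Type u} {m : ℕ} (h : m = m) (x : C m) : acast h x = x := rfl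

theorem acast_acast {C : ℕ → Type u} {a b c : ℕ} (h : a = b) (h' : b = c) (x : C a) :
    acast h' (acast h x) = acast (h.trans h') x := by
  subst h; subst h'; rfl

theorem PreSub.apply_castU (P : RenPreoperad) {m n n' : ℕ} (h : n = n') (s : PreSub P.C m n)
    (f : P.C n') : (castU h s).apply P f = s.apply P (acast h.symm f) := by
  subst h; rfl

/-- Applying words to elements respects the defining relations of `CSUB[V]`. -/
theorem CSubEquiv.apply_eq {V : CartOperad} {m n : ℕ} {s t : PreSub V.C m n}
    (h : CSubEquiv V s t) (f : V.C n) :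
    s.apply V.toRenPreoperad f = t.apply V.toRenPreoperad f := by
  induction h with
  | refl => rfl
  | symm _ ih => exact (ih f).symm
  | trans _ _ ih₁ ih₂ => exact (ih₁ f).trans (ih₂ f)
  | congrSub g _ ih => simp only [PreSub.apply, ih]
  | congrRen r _ ih => simp only [PreSub.apply, ih]
  | unit₁ s => simp only [PreSub.apply, V.right_unit]
  | unit₂ s => simp only [PreSub.apply, V.ren_id]
  | merge g h rest =>
    simp only [PreSub.apply, PreSub.apply_castU]
    exact congrArg _ (V.assoc f g h)
  | renComp r₁ r₂ rest => simp only [PreSub.apply, V.ren_comp]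
  | interchange v ρ₁ ρ ρ₂ rest => simp only [PreSub.apply, V.ren_subst]
  | symL g rest =>
    simp only [PreSub.apply, PreSub.apply_castU]
    exact congrArg _ (V.sym_nat₁ f g)
  | symR g rest =>
    simp only [PreSub.apply, PreSub.apply_castU]
    rw [V.sym_nat₂ f g, acast_acast]
  | @cen m₁ m m₂ n₁ n₂ g₁ g₂ rest =>
    simp only [PreSub.apply, PreSub.apply_castU]
    have key := (V.central g₁ g₂ m₁ m m₂ (acast (by omega) f)).1
    rw [acast_acast, acast_rfl] at key
    exact congrArg _ key
  | dis g rest =>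
    simp only [PreSub.apply]
    exact congrArg _ (V.discard_nat f g)
  | cop g rest =>
    simp only [PreSub.apply, PreSub.apply_castU]
    exact congrArg _ (V.copy_nat f g)

theorem PreSub.apply_sing (P : RenPreoperad) {n : ℕ} (v : P.C n) :
    (sing v).apply P P.one = v := by
  simp only [sing, apply, apply_castU, P.left_unit, acast_acast, acast_rfl]

theorem PreSub.sing_append {C : ℕ → Type} {m n : ℕ} (v : C n) (t : PreSub C m n) :
    (sing v).append t = .subCons 0 0 v (castU (by omega) t) := by
  have aux : ∀ {n' : ℕ} (h : n = n'),
      (castU h (.nil : PreSub C n n)).append t = castU h t := by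
    intro n' h; subst h; simp only [castU, append]
  simp only [sing, append, aux]

theorem bsum_bsum_zero {a b : ℕ} (r : Ren a b) (i : Fin (0 + a + 0)) :
    bsum (bsum (idRen 0) r) (idRen 0) i =
      Fin.cast (by omega) (r (Fin.cast (by omega) i)) := by
  have hi : i = Fin.castAdd 0 (Fin.natAdd 0 (Fin.cast (by omega) i)) := by
    ext; simp
  rw [hi]
  simp only [bsum, Fin.addCases_left, Fin.addCases_right]
  ext; simp

theorem bsum_bsum_idRen_zero : bsum (bsum (idRen 0) (idRen 1)) (idRen 0) = idRen (0 + 1 + 0) := by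
  funext i
  rw [bsum_bsum_zero]
  rfl

theorem PreSub.castU_renCons {C : ℕ → Type} {m a b a' b' : ℕ} (ha : a = a') (hb : b = b')
    (r : Ren a b) (rest : PreSub C m b) :
    castU ha (.renCons r rest) =
      .renCons (fun i => Fin.cast hb (r (Fin.cast ha.symm i))) (castU hb rest) := by
  subst ha; subst hb; rfl

theorem PreSub.castU_subCons {C : ℕ → Type} {m m₁ m₂ k a₁ a₂ : ℕ} (h₁ : m₁ = a₁) (h₂ : m₂ = a₂)
    (g : C k) (rest : PreSub C m (m₁ + k + m₂)) :
    castU (by omega) (.subCons m₁ m₂ g rest) =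
      .subCons a₁ a₂ g (castU (by omega) rest) := by
  subst h₁; subst h₂; rfl

theorem PreSub.castU_castU {C : ℕ → Type} {m a b c : ℕ} (h : a = b) (h' : b = c)
    (s : PreSub C m a) : castU h' (castU h s) = castU (h.trans h') s := by
  subst h; subst h'; rfl

/-- The assignment `v ↦ [⟨0 ⊣ v ⊢ 0⟩]` is natural with respect to the action of words. -/
theorem CSubEquiv.sing_apply {V : CartOperad} {m n : ℕ} (t : PreSub V.C m n) (v : V.C n) :
    CSubEquiv V (PreSub.sing (t.apply V.toRenPreoperad v)) ((PreSub.sing v).append t) := by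
  induction t with
  | nil =>
    rw [PreSub.sing_append, PreSub.apply]
    exact .refl _
  | subCons m₁ m₂ g rest ih =>
    rw [PreSub.apply]
    refine (ih (V.subst m₁ m₂ v g)).trans ?_
    rw [PreSub.sing_append, PreSub.sing_append]
    have key := CSubEquiv.merge (V := V) (m₁ := 0) (m₂ := 0) v g
      (PreSub.castU (by omega) rest)
    rw [PreSub.castU_castU] at key
    rw [← PreSub.castU_subCons (zero_add m₁).symm (add_zero m₂).symm g rest,
      PreSub.castU_castU] at key
    exact key.symm
  | renCons r rest ih =>
    rw [PreSub.apply]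
    refine (ih (V.ren v r)).trans ?_
    rw [PreSub.sing_append, PreSub.sing_append]
    have key := CSubEquiv.interchange (V := V) v (idRen 0) r (idRen 0)
      (PreSub.castU (by omega) rest)
    rw [bsum_bsum_idRen_zero, funext (bsum_bsum_zero r), ← PreSub.castU_renCons] at key
    exact ((key.trans (.unit₂ _)).symm)

theorem CSubEquiv.sing_apply_one {V : CartOperad} {n : ℕ} (s : PreSub V.C n 1) :
    CSubEquiv V (PreSub.sing (s.apply V.toRenPreoperad V.one)) s := by
  refine (CSubEquiv.sing_apply s V.one).trans ?_
  rw [PreSub.sing_append]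
  exact .unit₁ _

/-- Let `(V, C, I)` be a Freyd operad.  The presheaf
`V : CSUB[V]ᵒᵖ → Set` is representable by the object `1`: the map sending `v ∈ V n` to
the class of the singleton word `[⟨0 ⊣ v ⊢ 0⟩]` is a bijection `V n ≅ CSUB[V](n,1)`,
with inverse sending a class `s` to `id ⋆ s`, and this bijection is natural with respect
to the action of `CSUB[V]`. -/
theorem stmt10 (O : FreydOperad) (n : ℕ) :
    Function.Bijective
      (fun v : O.V.C n => (Quot.mk (@CSubEquiv O.V n 1) (PreSub.sing v) : CSUBQ O.V n 1)) ∧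
    (∀ v : O.V.C n, PreSub.apply O.V.toRenPreoperad (PreSub.sing v) O.V.one = v) ∧
    (∀ s : PreSub O.V.C n 1,
      (Quot.mk (@CSubEquiv O.V n 1)
          (PreSub.sing (PreSub.apply O.V.toRenPreoperad s O.V.one)) : CSUBQ O.V n 1) =
        Quot.mk _ s) ∧
    (∀ {m : ℕ} (t : PreSub O.V.C m n) (v : O.V.C n),
      CSubEquiv O.V (PreSub.sing (PreSub.apply O.V.toRenPreoperad t v))
        ((PreSub.sing v).append t)) := by
  refine ⟨⟨fun v w h => ?_, fun q => ?_⟩, PreSub.apply_sing _,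
    fun s => Quot.sound (CSubEquiv.sing_apply_one s), CSubEquiv.sing_apply⟩
  · have := congrArg (Quot.lift (fun s => PreSub.apply O.V.toRenPreoperad s O.V.one)
      fun _ _ h => h.apply_eq _) h
    simpa only [PreSub.apply_sing] using this
  · induction q using Quot.ind with
    | mk s => exact ⟨_, Quot.sound (CSubEquiv.sing_apply_one s)⟩
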